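/- arXiv:1702.08814 — 6 statements merged into one kernel-verified Lean document; each statement's English description precedes it below -/
import Mathlib

section
/- Let L, H_m > 0, let Ω₊ = (0,L)×(0,H_m), Ω₋ = (0,L)×(−H_m,0), Ω^m = Ω₊ ∪ Ω₋, and let 𝒦 > 0, D > 0, α_ex ≥ 0, f^m ∈ C(closure(Ω^m)), f^c ∈ C([0,L]). Suppose (u₁^m, u₁^c) and (u₂^m, u₂^c) are two classical solutions of the coupled continuum pipe-flow/Darcy system, i.e. each pair (u^m, u^c) satisfies: u^m is continuous on closure(Ω^m), is C² on Ω₊ and on Ω₋, is C¹ up to the interface segment (0,L)×{0} from each side and up to the outer boundary; u^c ∈ C²([0,L]); −𝒦 Δu^m = f^m in Ω₊ and in Ω₋; the flux-jump condition 𝒦(∂_y u^m(x,0⁺) − ∂_y u^m(x,0⁻)) = α_ex (u^m(x,0) − u^c(x)) holds for all x ∈ (0,L); −D (u^c)''(x) = α_ex (u^m(x,0) − u^c(x)) + f^c(x) on (0,L); u^m = 0 on ∂Ω^m and u^c(0) = u^c(L) = 0. Then u₁^m = u₂^m on Ω^m and u₁^c = u₂^c on [0,L]. -/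
open MeasureTheory Set

noncomputable section

/-- The upper half of the porous matrix domain, `Ω₊ = (0,L) × (0,Hₘ)`. -/
def OmegaPlus (L Hm : ℝ) : Set (ℝ × ℝ) := Ioo 0 L ×ˢ Ioo 0 Hm

/-- The lower half of the porous matrix domain, `Ω₋ = (0,L) × (-Hₘ,0)`. -/
def OmegaMinus (L Hm : ℝ) : Set (ℝ × ℝ) := Ioo 0 L ×ˢ Ioo (-Hm) 0

/-- The porous matrix domain `Ωᵐ = Ω₊ ∪ Ω₋`. -/
def OmegaM (L Hm : ℝ) : Set (ℝ × ℝ) := OmegaPlus L Hm ∪ OmegaMinus L Hm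

/-- The outer boundary `∂Ωᵐ` of the porous matrix (the boundary of the full
rectangle `(0,L) × (-Hₘ,Hₘ)`, which is the matrix domain including the interface). -/
def OuterBoundary (L Hm : ℝ) : Set (ℝ × ℝ) := frontier (Ioo 0 L ×ˢ Ioo (-Hm) Hm)

/-- The second pure `x`-derivative `∂²ₓ u` of `u : ℝ × ℝ → ℝ`. -/
def dxx (u : ℝ × ℝ → ℝ) (p : ℝ × ℝ) : ℝ :=
  fderiv ℝ (fun q => fderiv ℝ u q (1, 0)) p (1, 0)

/-- The second pure `y`-derivative `∂²_y u` of `u : ℝ × ℝ → ℝ`. -/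
def dyy (u : ℝ × ℝ → ℝ) (p : ℝ × ℝ) : ℝ :=
  fderiv ℝ (fun q => fderiv ℝ u q (0, 1)) p (0, 1)

/-- `(uᵐ, u^c)` is a classical solution of the coupled continuum pipe-flow/Darcy
system on `Ωᵐ ∪ Ω^c` with data `fᵐ, f^c`:  `uᵐ` is continuous on `closure Ωᵐ`, `C²` on
`Ω₊` and on `Ω₋`, `C¹` up to the interface from each side and up to the outer boundary
(encoded as `C¹` on the closures of `Ω₊` and of `Ω₋`); `u^c ∈ C²([0,L])`;
`-𝒦 Δuᵐ = fᵐ` in `Ω₊` and in `Ω₋`; the flux-jump condition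
`𝒦 (∂_y uᵐ(x,0⁺) - ∂_y uᵐ(x,0⁻)) = α (uᵐ(x,0) - u^c(x))` holds on `(0,L)`
(the one-sided normal derivatives being the `fderivWithin` with respect to the
closed upper/lower halves); `-D (u^c)'' = α (uᵐ(·,0) - u^c) + f^c` on `(0,L)`;
`uᵐ = 0` on `∂Ωᵐ` and `u^c(0) = u^c(L) = 0`. -/
structure IsCCPFSolution (L Hm 𝒦 D α : ℝ) (fm : ℝ × ℝ → ℝ) (fc : ℝ → ℝ)
    (um : ℝ × ℝ → ℝ) (uc : ℝ → ℝ) : Prop where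
  contM : ContinuousOn um (closure (OmegaM L Hm))
  c2plus : ContDiffOn ℝ 2 um (OmegaPlus L Hm)
  c2minus : ContDiffOn ℝ 2 um (OmegaMinus L Hm)
  c1plus : ContDiffOn ℝ 1 um (closure (OmegaPlus L Hm))
  c1minus : ContDiffOn ℝ 1 um (closure (OmegaMinus L Hm))
  c2cond : ContDiffOn ℝ 2 uc (Icc 0 L)
  pdePlus : ∀ p ∈ OmegaPlus L Hm, -(𝒦 * (dxx um p + dyy um p)) = fm p
  pdeMinus : ∀ p ∈ OmegaMinus L Hm, -(𝒦 * (dxx um p + dyy um p)) = fm p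
  fluxJump : ∀ x ∈ Ioo (0 : ℝ) L,
    𝒦 * (fderivWithin ℝ um (closure (OmegaPlus L Hm)) (x, 0) (0, 1)
          - fderivWithin ℝ um (closure (OmegaMinus L Hm)) (x, 0) (0, 1))
      = α * (um (x, 0) - uc x)
  odeCond : ∀ x ∈ Ioo (0 : ℝ) L,
    -(D * derivWithin (derivWithin uc (Icc 0 L)) (Icc 0 L) x)
      = α * (um (x, 0) - uc x) + fc x
  bdryM : ∀ p ∈ OuterBoundary L Hm, um p = 0
  bdryC0 : uc 0 = 0
  bdryCL : uc L = 0

/-- Second-derivative test: the second derivative is nonpositive at a local maximum. -/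
theorem IsLocalMax.second_deriv_nonpos {f f' : ℝ → ℝ} {a c : ℝ} (h : IsLocalMax f a)
    (hf : ∀ᶠ t in nhds a, HasDerivAt f (f' t) t) (hf' : HasDerivAt f' c a) : c ≤ 0 := by
  have hd : deriv f =ᶠ[nhds a] f' := hf.mono fun t ht => ht.deriv
  have hdd : deriv (deriv f) a = c := hd.deriv_eq.trans hf'.deriv
  by_contra! hc
  have hmin : IsLocalMin f a :=
    isLocalMin_of_deriv_deriv_pos (hdd ▸ hc) h.deriv_eq_zero hf.self_of_nhds.continuousAt
  have hconst : f =ᶠ[nhds a] fun _ => f a := by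
    filter_upwards [h, hmin] with t h1 h2 using le_antisymm h1 h2
  have h0 : deriv (deriv f) a = 0 := by
    rw [hconst.deriv.deriv_eq]
    simp
  linarith

theorem ContDiffOn.differentiableAt_fderiv_apply {f : ℝ × ℝ → ℝ} {U : Set (ℝ × ℝ)}
    (hf : ContDiffOn ℝ 2 f U) (hU : IsOpen U) {p : ℝ × ℝ} (hp : p ∈ U) (e : ℝ × ℝ) :
    DifferentiableAt ℝ (fun q => fderiv ℝ f q e) p := by
  have h1 : ContDiffOn ℝ 1 (fderiv ℝ f) U := hf.fderiv_of_isOpen hU (by norm_num)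
  exact ((h1.differentiableOn (by norm_num)).differentiableAt (hU.mem_nhds hp)).clm_apply
    (differentiableAt_const e)

theorem fderiv_fderiv_sub_apply {f g : ℝ × ℝ → ℝ} {U : Set (ℝ × ℝ)}
    (hf : ContDiffOn ℝ 2 f U) (hg : ContDiffOn ℝ 2 g U) (hU : IsOpen U)
    {p : ℝ × ℝ} (hp : p ∈ U) (e : ℝ × ℝ) :
    fderiv ℝ (fun q => fderiv ℝ (f - g) q e) p e
      = fderiv ℝ (fun q => fderiv ℝ f q e) p e - fderiv ℝ (fun q => fderiv ℝ g q e) p e := by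
  have h : (fun q => fderiv ℝ (f - g) q e) =ᶠ[nhds p]
      fun q => fderiv ℝ f q e - fderiv ℝ g q e := by
    filter_upwards [hU.mem_nhds hp] with q hq
    rw [fderiv_sub ((hf.differentiableOn (by norm_num)).differentiableAt (hU.mem_nhds hq))
      ((hg.differentiableOn (by norm_num)).differentiableAt (hU.mem_nhds hq))]
    rfl
  rw [h.fderiv_eq, fderiv_fun_sub (hf.differentiableAt_fderiv_apply hU hp e)
    (hg.differentiableAt_fderiv_apply hU hp e)]
  rfl

theorem IsLocalMax.fderiv_fderiv_nonpos {f : ℝ × ℝ → ℝ} {U : Set (ℝ × ℝ)}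
    (hf : ContDiffOn ℝ 2 f U) (hU : IsOpen U) {p : ℝ × ℝ} (hp : p ∈ U)
    (hmax : IsLocalMax f p) (e : ℝ × ℝ) :
    fderiv ℝ (fun q => fderiv ℝ f q e) p e ≤ 0 := by
  have hline : ∀ t : ℝ, HasDerivAt (fun t : ℝ => p + t • e) e t := fun t => by
    simpa using ((hasDerivAt_id t).smul_const e).const_add p
  have htend : Filter.Tendsto (fun t : ℝ => p + t • e) (nhds 0) (nhds p) := by
    simpa [ContinuousAt] using (hline 0).continuousAt
  refine IsLocalMax.second_deriv_nonpos (f := fun t : ℝ => f (p + t • e)) (a := 0)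
    (f' := fun t => fderiv ℝ f (p + t • e) e) ?_ ?_ ?_
  · simpa [IsLocalMax, IsMaxFilter] using htend.eventually hmax
  · filter_upwards [htend.eventually (hU.mem_nhds hp)] with t ht
    exact (((hf.differentiableOn (by norm_num)).differentiableAt
      (hU.mem_nhds ht)).hasFDerivAt).comp_hasDerivAt t (hline t)
  · have h := (hf.differentiableAt_fderiv_apply hU hp e).hasFDerivAt
    have h' : HasFDerivAt (fun q => fderiv ℝ f q e)
        (fderiv ℝ (fun q => fderiv ℝ f q e) p) (p + (0 : ℝ) • e) := by simpa using h
    exact h'.comp_hasDerivAt (0 : ℝ) (hline 0)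

/-- The quadratic perturbation `ε (s y + y²)`, strictly subharmonic for `ε > 0`. -/
def quadBarrier (ε s : ℝ) (q : ℝ × ℝ) : ℝ := ε * (s * q.2 + q.2 ^ 2)

theorem contDiff_quadBarrier (ε s : ℝ) {n : WithTop ℕ∞} : ContDiff ℝ n (quadBarrier ε s) := by
  unfold quadBarrier
  fun_prop

theorem hasFDerivAt_quadBarrier (ε s : ℝ) (p : ℝ × ℝ) :
    HasFDerivAt (quadBarrier ε s)
      ((ε * (s + 2 * p.2)) • ContinuousLinearMap.snd ℝ ℝ ℝ) p := by
  have h1 : HasDerivAt (fun y : ℝ => ε * (s * y + y ^ 2)) (ε * (s + 2 * p.2)) p.2 := by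
    have := (((hasDerivAt_id p.2).const_mul s).add ((hasDerivAt_id p.2).pow 2)).const_mul ε
    simpa using this
  exact h1.comp_hasFDerivAt p hasFDerivAt_snd

theorem fderiv_quadBarrier_apply (ε s : ℝ) (p e : ℝ × ℝ) :
    fderiv ℝ (quadBarrier ε s) p e = ε * (s + 2 * p.2) * e.2 := by
  rw [(hasFDerivAt_quadBarrier ε s p).fderiv]
  rfl

theorem fderiv_fderiv_quadBarrier (ε s : ℝ) (p e : ℝ × ℝ) :
    fderiv ℝ (fun q => fderiv ℝ (quadBarrier ε s) q e) p e = 2 * ε * e.2 ^ 2 := by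
  simp only [fderiv_quadBarrier_apply]
  have h1 : HasDerivAt (fun y : ℝ => ε * (s + 2 * y) * e.2) (ε * 2 * e.2) p.2 := by
    have := ((((hasDerivAt_id p.2).const_mul 2).const_add s).const_mul ε).mul_const e.2
    simpa using this
  have h2 : HasFDerivAt (fun q : ℝ × ℝ => ε * (s + 2 * q.2) * e.2)
      ((ε * 2 * e.2) • ContinuousLinearMap.snd ℝ ℝ ℝ) p :=
    h1.comp_hasFDerivAt p hasFDerivAt_snd
  rw [h2.fderiv]
  simp only [smul_apply, ContinuousLinearMap.coe_snd', smul_eq_mul]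
  ring

theorem not_isLocalMax_sub_quadBarrier {w : ℝ × ℝ → ℝ} {U : Set (ℝ × ℝ)}
    (hw : ContDiffOn ℝ 2 w U) (hU : IsOpen U) {p : ℝ × ℝ} (hp : p ∈ U)
    (hharm : dxx w p + dyy w p = 0) {ε s : ℝ} (hε : ε < 0) :
    ¬ IsLocalMax (w - quadBarrier ε s) p := by
  intro hmax
  have hq : ContDiffOn ℝ 2 (quadBarrier ε s) U := (contDiff_quadBarrier ε s).contDiffOn
  have hwq : ContDiffOn ℝ 2 (w - quadBarrier ε s) U := hw.sub hq
  have hx := hmax.fderiv_fderiv_nonpos hwq hU hp (1, 0)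
  have hy := hmax.fderiv_fderiv_nonpos hwq hU hp (0, 1)
  rw [fderiv_fderiv_sub_apply hw hq hU hp, fderiv_fderiv_quadBarrier] at hx hy
  unfold dxx dyy at hharm
  norm_num at hx hy
  linarith

theorem isOpen_OmegaPlus (L Hm : ℝ) : IsOpen (OmegaPlus L Hm) := isOpen_Ioo.prod isOpen_Ioo

theorem isOpen_OmegaMinus (L Hm : ℝ) : IsOpen (OmegaMinus L Hm) := isOpen_Ioo.prod isOpen_Ioo

theorem closure_OmegaPlus {L Hm : ℝ} (hL : 0 < L) (hHm : 0 < Hm) :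
    closure (OmegaPlus L Hm) = Icc 0 L ×ˢ Icc 0 Hm := by
  rw [OmegaPlus, closure_prod_eq, closure_Ioo hL.ne, closure_Ioo hHm.ne]

theorem closure_OmegaMinus {L Hm : ℝ} (hL : 0 < L) (hHm : 0 < Hm) :
    closure (OmegaMinus L Hm) = Icc 0 L ×ˢ Icc (-Hm) 0 := by
  rw [OmegaMinus, closure_prod_eq, closure_Ioo hL.ne, closure_Ioo (by linarith)]

theorem closure_OmegaM {L Hm : ℝ} (hL : 0 < L) (hHm : 0 < Hm) :
    closure (OmegaM L Hm) = Icc 0 L ×ˢ Icc (-Hm) Hm := by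
  rw [OmegaM, closure_union, closure_OmegaPlus hL hHm, closure_OmegaMinus hL hHm,
    ← prod_union, union_comm, Icc_union_Icc_eq_Icc (by linarith) hHm.le]

theorem mem_OuterBoundary {L Hm : ℝ} (hL : 0 < L) (hHm : 0 < Hm) {p : ℝ × ℝ} :
    p ∈ OuterBoundary L Hm ↔
      p ∈ Icc 0 L ×ˢ Icc (-Hm) Hm ∧ p ∉ Ioo 0 L ×ˢ Ioo (-Hm) Hm := by
  rw [OuterBoundary, (isOpen_Ioo.prod isOpen_Ioo).frontier_eq, closure_prod_eq,
    closure_Ioo hL.ne, closure_Ioo (by linarith), mem_sdiff]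

theorem uniqueDiffOn_closure_OmegaPlus {L Hm : ℝ} (hL : 0 < L) (hHm : 0 < Hm) :
    UniqueDiffOn ℝ (closure (OmegaPlus L Hm)) := by
  rw [closure_OmegaPlus hL hHm]
  exact (uniqueDiffOn_Icc hL).prod (uniqueDiffOn_Icc hHm)

theorem uniqueDiffOn_closure_OmegaMinus {L Hm : ℝ} (hL : 0 < L) (hHm : 0 < Hm) :
    UniqueDiffOn ℝ (closure (OmegaMinus L Hm)) := by
  rw [closure_OmegaMinus hL hHm]
  exact (uniqueDiffOn_Icc hL).prod (uniqueDiffOn_Icc (by linarith))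

theorem derivWithin_derivWithin_sub {f g : ℝ → ℝ} {s : Set ℝ} (hs : UniqueDiffOn ℝ s)
    (hf : ContDiffOn ℝ 2 f s) (hg : ContDiffOn ℝ 2 g s) {x : ℝ} (hx : x ∈ s) :
    derivWithin (derivWithin (f - g) s) s x
      = derivWithin (derivWithin f s) s x - derivWithin (derivWithin g s) s x := by
  have h : ∀ y ∈ s, derivWithin (f - g) s y = (derivWithin f s - derivWithin g s) y :=
    fun y hy => derivWithin_sub (hf.differentiableOn (by norm_num) y hy)
      (hg.differentiableOn (by norm_num) y hy)
  rw [derivWithin_congr h (h x hx)]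
  exact derivWithin_sub
    ((hf.derivWithin hs (m := 1) (by norm_num)).differentiableOn (by norm_num) x hx)
    ((hg.derivWithin hs (m := 1) (by norm_num)).differentiableOn (by norm_num) x hx)

/-- The difference of two solutions solves the homogeneous system. -/
theorem IsCCPFSolution.sub {L Hm 𝒦 D α : ℝ} (hL : 0 < L) (hHm : 0 < Hm)
    {fm : ℝ × ℝ → ℝ} {fc : ℝ → ℝ} {u1m u2m : ℝ × ℝ → ℝ} {u1c u2c : ℝ → ℝ}
    (h1 : IsCCPFSolution L Hm 𝒦 D α fm fc u1m u1c)
    (h2 : IsCCPFSolution L Hm 𝒦 D α fm fc u2m u2c) :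
    IsCCPFSolution L Hm 𝒦 D α 0 0 (u1m - u2m) (u1c - u2c) where
  contM := h1.contM.sub h2.contM
  c2plus := h1.c2plus.sub h2.c2plus
  c2minus := h1.c2minus.sub h2.c2minus
  c1plus := h1.c1plus.sub h2.c1plus
  c1minus := h1.c1minus.sub h2.c1minus
  c2cond := h1.c2cond.sub h2.c2cond
  pdePlus p hp := by
    have e1 := h1.pdePlus p hp
    have e2 := h2.pdePlus p hp
    unfold dxx dyy at *
    rw [fderiv_fderiv_sub_apply h1.c2plus h2.c2plus (isOpen_OmegaPlus L Hm) hp,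
      fderiv_fderiv_sub_apply h1.c2plus h2.c2plus (isOpen_OmegaPlus L Hm) hp, Pi.zero_apply]
    linarith
  pdeMinus p hp := by
    have e1 := h1.pdeMinus p hp
    have e2 := h2.pdeMinus p hp
    unfold dxx dyy at *
    rw [fderiv_fderiv_sub_apply h1.c2minus h2.c2minus (isOpen_OmegaMinus L Hm) hp,
      fderiv_fderiv_sub_apply h1.c2minus h2.c2minus (isOpen_OmegaMinus L Hm) hp, Pi.zero_apply]
    linarith
  fluxJump x hx := by
    have e1 := h1.fluxJump x hx
    have e2 := h2.fluxJump x hx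
    have hp : ((x, 0) : ℝ × ℝ) ∈ closure (OmegaPlus L Hm) := by
      rw [closure_OmegaPlus hL hHm]
      exact ⟨Ioo_subset_Icc_self hx, left_mem_Icc.2 hHm.le⟩
    have hm : ((x, 0) : ℝ × ℝ) ∈ closure (OmegaMinus L Hm) := by
      rw [closure_OmegaMinus hL hHm]
      exact ⟨Ioo_subset_Icc_self hx, right_mem_Icc.2 (by linarith)⟩
    rw [fderivWithin_sub (uniqueDiffOn_closure_OmegaPlus hL hHm _ hp)
        (h1.c1plus.differentiableOn (by norm_num) _ hp)
        (h2.c1plus.differentiableOn (by norm_num) _ hp),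
      fderivWithin_sub (uniqueDiffOn_closure_OmegaMinus hL hHm _ hm)
        (h1.c1minus.differentiableOn (by norm_num) _ hm)
        (h2.c1minus.differentiableOn (by norm_num) _ hm)]
    simp only [sub_apply, Pi.sub_apply]
    linarith
  odeCond x hx := by
    have e1 := h1.odeCond x hx
    have e2 := h2.odeCond x hx
    rw [derivWithin_derivWithin_sub (uniqueDiffOn_Icc hL) h1.c2cond h2.c2cond
      (Ioo_subset_Icc_self hx)]
    simp only [Pi.sub_apply, Pi.zero_apply]
    linarith
  bdryM p hp := by simp [h1.bdryM p hp, h2.bdryM p hp]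
  bdryC0 := by simp [h1.bdryC0, h2.bdryC0]
  bdryCL := by simp [h1.bdryCL, h2.bdryCL]

theorem derivWithin_derivWithin_le_of_isMaxOn {v : ℝ → ℝ} {a b ε x : ℝ} (hab : a < b)
    (hv : ContDiffOn ℝ 2 v (Icc a b)) (hx : x ∈ Ioo a b)
    (hmax : IsMaxOn (fun t => v t + ε * t ^ 2) (Icc a b) x) :
    derivWithin (derivWithin v (Icc a b)) (Icc a b) x ≤ -(2 * ε) := by
  have hdv : DifferentiableOn ℝ (derivWithin v (Icc a b)) (Icc a b) :=
    (hv.derivWithin (uniqueDiffOn_Icc hab) (m := 1) (by norm_num)).differentiableOn (by norm_num)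
  have key := IsLocalMax.second_deriv_nonpos
    (f' := fun t => derivWithin v (Icc a b) t + ε * (2 * t))
    (c := derivWithin (derivWithin v (Icc a b)) (Icc a b) x + ε * 2)
    (hmax.isLocalMax (Icc_mem_nhds hx.1 hx.2)) ?_ ?_
  · linarith
  · filter_upwards [Ioo_mem_nhds hx.1 hx.2] with t ht
    have h1 := ((hv.differentiableOn (by norm_num) t
      (Ioo_subset_Icc_self ht)).hasDerivWithinAt).hasDerivAt (Icc_mem_nhds ht.1 ht.2)
    have h2 := ((hasDerivAt_id t).pow 2).const_mul ε
    simpa using h1.fun_add h2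
  · have h1 := ((hdv x (Ioo_subset_Icc_self hx)).hasDerivWithinAt).hasDerivAt
      (Icc_mem_nhds hx.1 hx.2)
    have h2 := ((hasDerivAt_id x).const_mul 2).const_mul ε
    simpa using h1.fun_add h2

/-- At a maximum of `w - quadBarrier ε s` over `S`, the one-sided derivative of `w` in a
direction `(0, h)` pointing into `S` is at most that of the barrier. -/
theorem fderivWithin_mul_le_of_isMaxOn {w : ℝ × ℝ → ℝ} {S : Set (ℝ × ℝ)} {x ε s h : ℝ}
    (hw : DifferentiableWithinAt ℝ w S (x, 0))
    (hmax : IsMaxOn (w - quadBarrier ε s) S (x, 0))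
    (hseg : segment ℝ ((x, 0) : ℝ × ℝ) ((x, 0) + (0, h)) ⊆ S) :
    fderivWithin ℝ w S (x, 0) (0, 1) * h ≤ ε * s * h := by
  have h1 := hw.hasFDerivWithinAt.sub (hasFDerivAt_quadBarrier ε s (x, 0)).hasFDerivWithinAt
  have h2 := hmax.localize.hasFDerivWithinAt_nonpos h1
    (mem_posTangentConeAt_of_segment_subset hseg)
  have h3 : ((0, h) : ℝ × ℝ) = h • ((0, 1) : ℝ × ℝ) := by simp
  rw [h3, map_smul] at h2
  simp only [sub_apply, smul_apply,
    ContinuousLinearMap.coe_snd', smul_eq_mul] at h2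
  linarith

theorem segment_vertical_subset {x h : ℝ} {I J : Set ℝ} (hI : Convex ℝ I) (hJ : Convex ℝ J)
    (hx : x ∈ I) (h0 : 0 ∈ J) (hh : h ∈ J) :
    segment ℝ ((x, 0) : ℝ × ℝ) ((x, 0) + (0, h)) ⊆ I ×ˢ J :=
  (hI.prod hJ).segment_subset ⟨hx, h0⟩ (by simpa using And.intro hx hh)

/-- Perturbed weak maximum principle for the matrix component of the homogeneous system. -/
theorem IsCCPFSolution.matrix_le {L Hm 𝒦 D α : ℝ} (hL : 0 < L) (hHm : 0 < Hm)
    (h𝒦 : 0 < 𝒦) (hD : 0 < D) (hα : 0 ≤ α) {w : ℝ × ℝ → ℝ} {v : ℝ → ℝ}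
    (h : IsCCPFSolution L Hm 𝒦 D α 0 0 w v) {ε : ℝ} (hε : 0 < ε) {p : ℝ × ℝ}
    (hp : p ∈ Icc 0 L ×ˢ Icc (-Hm) Hm) : w p ≤ ε * (Hm + Hm ^ 2) := by
  set W : ℝ × ℝ → ℝ := fun q => w q + ε * (|q.2| + q.2 ^ 2) with hW
  have hcl := closure_OmegaM hL hHm
  have hWc : ContinuousOn W (Icc 0 L ×ˢ Icc (-Hm) Hm) :=
    (hcl ▸ h.contM).add (by fun_prop)
  obtain ⟨m, hm, hmax⟩ := (isCompact_Icc.prod isCompact_Icc).exists_isMaxOn ⟨p, hp⟩ hWc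
  have hpm : W p ≤ W m := hmax hp
  have hpw : w p ≤ W p := by
    have : 0 ≤ ε * (|p.2| + p.2 ^ 2) := by positivity
    simp only [hW]
    linarith
  have hWplus : ∀ q : ℝ × ℝ, 0 ≤ q.2 → (w - quadBarrier (-ε) 1) q = W q := fun q hq => by
    simp only [hW, quadBarrier, Pi.sub_apply, abs_of_nonneg hq]
    ring
  have hWminus : ∀ q : ℝ × ℝ, q.2 ≤ 0 → (w - quadBarrier (-ε) (-1)) q = W q := fun q hq => by
    simp only [hW, quadBarrier, Pi.sub_apply, abs_of_nonpos hq]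
    ring
  by_cases hout : m ∈ OuterBoundary L Hm
  · have h1 : |m.2| ≤ Hm := abs_le.2 hm.2
    have h2 : m.2 ^ 2 ≤ Hm ^ 2 := sq_le_sq' hm.2.1 hm.2.2
    have h3 : W m ≤ ε * (Hm + Hm ^ 2) := by
      simp only [hW, h.bdryM m hout, zero_add]
      gcongr
    linarith
  exfalso
  have hin : m ∈ Ioo 0 L ×ˢ Ioo (-Hm) Hm := by
    by_contra hc
    exact hout ((mem_OuterBoundary hL hHm).2 ⟨hm, hc⟩)
  have hloc : IsLocalMax W m := hmax.isLocalMax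
    (Filter.mem_of_superset ((isOpen_Ioo.prod isOpen_Ioo).mem_nhds hin)
      (prod_mono Ioo_subset_Icc_self Ioo_subset_Icc_self))
  have hharm : ∀ {a : ℝ}, -(𝒦 * a) = 0 → a = 0 := fun ha => by
    simpa [h𝒦.ne'] using ha
  rcases lt_trichotomy m.2 0 with hneg | hzero | hpos
  · have hmem : m ∈ OmegaMinus L Hm := ⟨hin.1, hin.2.1, hneg⟩
    refine not_isLocalMax_sub_quadBarrier h.c2minus (isOpen_OmegaMinus L Hm) hmem
      (hharm (h.pdeMinus m hmem)) (ε := -ε) (s := -1) (by linarith) (hloc.congr ?_)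
    filter_upwards [(isOpen_OmegaMinus L Hm).mem_nhds hmem] with q hq
    exact (hWminus q hq.2.2.le).symm
  · obtain ⟨x, y⟩ := m
    simp only at hzero
    subst hzero
    have hx : x ∈ Ioo 0 L := hin.1
    have hx' : x ∈ Icc 0 L := hm.1
    have hjump := h.fluxJump x hx
    have hplus : fderivWithin ℝ w (closure (OmegaPlus L Hm)) (x, 0) (0, 1) ≤ -ε := by
      have hS : closure (OmegaPlus L Hm) = Icc 0 L ×ˢ Icc 0 Hm := closure_OmegaPlus hL hHm
      have h0 : (0 : ℝ) ∈ Icc 0 Hm := left_mem_Icc.2 hHm.le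
      have key := fderivWithin_mul_le_of_isMaxOn (ε := -ε) (s := 1) (h := Hm)
        (h.c1plus.differentiableOn (by norm_num) (x, 0) (hS ▸ ⟨hx', h0⟩)) ?_
        (hS ▸ segment_vertical_subset (convex_Icc 0 L) (convex_Icc 0 Hm) hx' h0
          (right_mem_Icc.2 hHm.le))
      · nlinarith
      · intro q hq
        rw [hS] at hq
        rw [mem_ofPred_eq, hWplus q hq.2.1, hWplus (x, 0) le_rfl]
        exact hmax ⟨hq.1, by linarith [hq.2.1], hq.2.2⟩
    have hminus : ε ≤ fderivWithin ℝ w (closure (OmegaMinus L Hm)) (x, 0) (0, 1) := by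
      have hS : closure (OmegaMinus L Hm) = Icc 0 L ×ˢ Icc (-Hm) 0 := closure_OmegaMinus hL hHm
      have h0 : (0 : ℝ) ∈ Icc (-Hm) 0 := right_mem_Icc.2 (by linarith)
      have key := fderivWithin_mul_le_of_isMaxOn (ε := -ε) (s := -1) (h := -Hm)
        (h.c1minus.differentiableOn (by norm_num) (x, 0) (hS ▸ ⟨hx', h0⟩)) ?_
        (hS ▸ segment_vertical_subset (convex_Icc 0 L) (convex_Icc (-Hm) 0) hx' h0
          (left_mem_Icc.2 (by linarith)))
      · nlinarith
      · intro q hq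
        rw [hS] at hq
        rw [mem_ofPred_eq, hWminus q hq.2.2, hWminus (x, 0) le_rfl]
        exact hmax ⟨hq.1, hq.2.1, by linarith [hq.2.2]⟩
    have hneg : α * (w (x, 0) - v x) < 0 := by
      rw [← hjump]
      exact mul_neg_of_pos_of_neg h𝒦 (by linarith)
    have hαpos : 0 < α := hα.lt_of_ne fun h0 => by simp [← h0] at hneg
    have hwv : w (x, 0) < v x := by
      by_contra! hc
      exact hneg.not_ge (mul_nonneg hα (by linarith))
    have hW0 : ∀ t, W (t, 0) = w (t, 0) := fun t => by simp [hW]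
    have hint : ∀ t ∈ Icc 0 L, w (t, 0) ≤ w (x, 0) := fun t ht => by
      rw [← hW0, ← hW0]
      exact hmax ⟨ht, hm.2⟩
    obtain ⟨z, hz, hzmax⟩ := isCompact_Icc.exists_isMaxOn ⟨x, hx'⟩ h.c2cond.continuousOn
    have hxz : v x ≤ v z := hzmax hx'
    have hw0 : w (0, 0) = 0 := h.bdryM _ ((mem_OuterBoundary hL hHm).2
      ⟨⟨left_mem_Icc.2 hL.le, hm.2⟩, fun hc => lt_irrefl _ hc.1.1⟩)
    have hwx : 0 ≤ w (x, 0) := hw0.symm.le.trans (hint 0 (left_mem_Icc.2 hL.le))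
    have hz' : z ∈ Ioo 0 L := by
      refine ⟨hz.1.lt_of_ne ?_, hz.2.lt_of_ne ?_⟩
      · rintro rfl
        linarith [h.bdryC0]
      · rintro rfl
        linarith [h.bdryCL]
    have hdd := derivWithin_derivWithin_le_of_isMaxOn (ε := 0) hL h.c2cond hz' (by simpa using hzmax)
    have hode := h.odeCond z hz'
    rw [Pi.zero_apply] at hode
    have h1 : 0 ≤ α * (w (z, 0) - v z) := by nlinarith
    have h2 : 0 ≤ w (z, 0) - v z := nonneg_of_mul_nonneg_right h1 hαpos
    linarith [hint z hz]
  · have hmem : m ∈ OmegaPlus L Hm := ⟨hin.1, hpos, hin.2.2⟩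
    refine not_isLocalMax_sub_quadBarrier h.c2plus (isOpen_OmegaPlus L Hm) hmem
      (hharm (h.pdePlus m hmem)) (ε := -ε) (s := 1) (by linarith) (hloc.congr ?_)
    filter_upwards [(isOpen_OmegaPlus L Hm).mem_nhds hmem] with q hq
    exact (hWplus q hq.2.1.le).symm

theorem nonpos_of_forall_le_mul {a C : ℝ} (h : ∀ ε > 0, a ≤ ε * C) : a ≤ 0 := by
  by_contra! ha
  have h1 := h (a / (2 * (|C| + 1))) (by positivity)
  have h2 : a / (2 * (|C| + 1)) * C ≤ a / (2 * (|C| + 1)) * (|C| + 1) := by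
    gcongr
    linarith [le_abs_self C]
  have h3 : a / (2 * (|C| + 1)) * (|C| + 1) = a / 2 := by field_simp
  linarith

theorem IsCCPFSolution.matrix_nonpos {L Hm 𝒦 D α : ℝ} (hL : 0 < L) (hHm : 0 < Hm)
    (h𝒦 : 0 < 𝒦) (hD : 0 < D) (hα : 0 ≤ α) {w : ℝ × ℝ → ℝ} {v : ℝ → ℝ}
    (h : IsCCPFSolution L Hm 𝒦 D α 0 0 w v) {p : ℝ × ℝ}
    (hp : p ∈ Icc 0 L ×ˢ Icc (-Hm) Hm) : w p ≤ 0 :=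
  nonpos_of_forall_le_mul fun _ hε => h.matrix_le hL hHm h𝒦 hD hα hε hp

theorem IsCCPFSolution.conduit_nonpos {L Hm 𝒦 D α : ℝ} (hL : 0 < L) (hHm : 0 < Hm)
    (h𝒦 : 0 < 𝒦) (hD : 0 < D) (hα : 0 ≤ α) {w : ℝ × ℝ → ℝ} {v : ℝ → ℝ}
    (h : IsCCPFSolution L Hm 𝒦 D α 0 0 w v) {x : ℝ} (hx : x ∈ Icc 0 L) : v x ≤ 0 := by
  refine nonpos_of_forall_le_mul (C := L ^ 2) fun ε hε => ?_
  obtain ⟨z, hz, hzmax⟩ := isCompact_Icc.exists_isMaxOn ⟨x, hx⟩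
    (h.c2cond.continuousOn.add (f := v) (g := fun t => ε * t ^ 2) (by fun_prop))
  have hxz : v x + ε * x ^ 2 ≤ v z + ε * z ^ 2 := hzmax hx
  have hzL : ε * z ^ 2 ≤ ε * L ^ 2 := by
    have := hz.1
    have := hz.2
    gcongr
  have hεx : 0 ≤ ε * x ^ 2 := by positivity
  suffices v z ≤ 0 by linarith
  rcases hz.1.eq_or_lt with h0 | h0
  · rw [← h0, h.bdryC0]
  rcases hz.2.eq_or_lt with h1 | h1
  · rw [h1, h.bdryCL]
  have hdd := derivWithin_derivWithin_le_of_isMaxOn hL h.c2cond ⟨h0, h1⟩ hzmax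
  have hode := h.odeCond z ⟨h0, h1⟩
  rw [Pi.zero_apply] at hode
  have hw : w (z, 0) ≤ 0 :=
    h.matrix_nonpos hL hHm h𝒦 hD hα ⟨hz, by constructor <;> simp [hHm.le]⟩
  by_contra! hc
  have hge : 0 ≤ α * (v z - w (z, 0)) := mul_nonneg hα (by linarith)
  nlinarith

theorem OmegaM_subset {L Hm : ℝ} (hL : 0 < L) (hHm : 0 < Hm) :
    OmegaM L Hm ⊆ Icc 0 L ×ˢ Icc (-Hm) Hm :=
  closure_OmegaM hL hHm ▸ subset_closure

/-- **Uniqueness for the CCPF/Darcy model.**  If `(u₁ᵐ, u₁^c)` and `(u₂ᵐ, u₂^c)` are two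
classical solutions of the coupled continuum pipe-flow/Darcy system with the same data
`fᵐ ∈ C(closure Ωᵐ)`, `f^c ∈ C([0,L])`, the same constants `𝒦, D > 0`, `α_ex ≥ 0`, and
homogeneous Dirichlet boundary conditions, then `u₁ᵐ = u₂ᵐ` on `Ωᵐ` and `u₁^c = u₂^c`
on `[0,L]`. -/
theorem ccpf_uniqueness (L Hm 𝒦 D α : ℝ) (hL : 0 < L) (hHm : 0 < Hm)
    (h𝒦 : 0 < 𝒦) (hD : 0 < D) (hα : 0 ≤ α)
    (fm : ℝ × ℝ → ℝ) (fc : ℝ → ℝ)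
    (hfm : ContinuousOn fm (closure (OmegaM L Hm)))
    (hfc : ContinuousOn fc (Icc 0 L))
    (u1m u2m : ℝ × ℝ → ℝ) (u1c u2c : ℝ → ℝ)
    (h1 : IsCCPFSolution L Hm 𝒦 D α fm fc u1m u1c)
    (h2 : IsCCPFSolution L Hm 𝒦 D α fm fc u2m u2c) :
    (∀ p ∈ OmegaM L Hm, u1m p = u2m p) ∧ ∀ x ∈ Icc (0 : ℝ) L, u1c x = u2c x := by
  have h12 := h1.sub hL hHm h2
  have h21 := h2.sub hL hHm h1
  refine ⟨fun p hp => ?_, fun x hx => ?_⟩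
  · have hp' := OmegaM_subset hL hHm hp
    exact le_antisymm (sub_nonpos.1 (h12.matrix_nonpos hL hHm h𝒦 hD hα hp'))
      (sub_nonpos.1 (h21.matrix_nonpos hL hHm h𝒦 hD hα hp'))
  · exact le_antisymm (sub_nonpos.1 (h12.conduit_nonpos hL hHm h𝒦 hD hα hx))
      (sub_nonpos.1 (h21.conduit_nonpos hL hHm h𝒦 hD hα hx))

end
end

section
/- Let L, H_m > 0, let Ω₊ = (0,L)×(0,H_m), Ω₋ = (0,L)×(−H_m,0), Ω^m = Ω₊ ∪ Ω₋, and let 𝒦 > 0, D > 0, α_ex ≥ 0. For v^m continuous on closure(Ω^m), C¹ on the closures of Ω₊ and of Ω₋, with v^m = 0 on ∂Ω^m, and v^c ∈ C¹([0,L]) with v^c(0) = v^c(L) = 0, define a(v,v) := 𝒦 ∫_{Ω^m} |∇v^m|² + D ∫₀^L ((v^c)')² + α_ex ∫₀^L (v^m(x,0) − v^c(x)) v^m(x,0) dx − α_ex ∫₀^L (v^m(x,0) − v^c(x)) v^c(x) dx. Then (i) a(v,v) = 𝒦 ∫_{Ω^m} |∇v^m|² + D ∫₀^L ((v^c)')²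 + α_ex ∫₀^L (v^m(x,0) − v^c(x))² dx, and (ii) there exists c > 0 depending only on 𝒦, D and L (not on α_ex, v^m, v^c) such that a(v,v) ≥ c ( ∫_{Ω^m} |∇v^m|² + ∫₀^L (v^c)² + ∫₀^L ((v^c)')² ). -/
open MeasureTheory Set

noncomputable section

/-- The squared gradient `|∇v|² = (∂ₓ v)² + (∂_y v)²`. -/
def gradSq (v : ℝ × ℝ → ℝ) (p : ℝ × ℝ) : ℝ :=
  (fderiv ℝ v p (1, 0)) ^ 2 + (fderiv ℝ v p (0, 1)) ^ 2

/-- The quadratic form `a(v,v)` of the CCPF model: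
`a(v,v) = 𝒦 ∫_{Ωᵐ} |∇vᵐ|² + D ∫₀^L ((v^c)')²
  + α_ex ∫₀^L (vᵐ(x,0) - v^c(x)) vᵐ(x,0) dx - α_ex ∫₀^L (vᵐ(x,0) - v^c(x)) v^c(x) dx`. -/
def aQuad (𝒦 D L Hm α : ℝ) (vm : ℝ × ℝ → ℝ) (vc : ℝ → ℝ) : ℝ :=
  𝒦 * (∫ p in OmegaM L Hm, gradSq vm p)
    + D * (∫ x in Ioo (0 : ℝ) L, (derivWithin vc (Icc 0 L) x) ^ 2)
    + α * (∫ x in Ioo (0 : ℝ) L, (vm (x, 0) - vc x) * vm (x, 0))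
    - α * (∫ x in Ioo (0 : ℝ) L, (vm (x, 0) - vc x) * vc x)

/-- Pointwise Cauchy–Schwarz bound for a `C¹` function on `[0, L]` vanishing at `0`. -/
theorem sq_le_mul_setIntegral_derivWithin_sq {L : ℝ} (hL : 0 < L) {v : ℝ → ℝ}
    (hv : ContDiffOn ℝ 1 v (Icc 0 L)) (hv0 : v 0 = 0) {x : ℝ} (hx : x ∈ Icc 0 L) :
    v x ^ 2 ≤ L * ∫ y in Ioo 0 L, derivWithin v (Icc 0 L) y ^ 2 := by
  set g := derivWithin v (Icc 0 L) with hg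
  have hgc : ContinuousOn g (Icc 0 L) :=
    hv.continuousOn_derivWithin (uniqueDiffOn_Icc hL) le_rfl
  have hsub : Icc 0 x ⊆ Icc 0 L := Icc_subset_Icc_right hx.2
  have hgx : ContinuousOn g (Icc 0 x) := hgc.mono hsub
  have hgi : IntervalIntegrable g volume 0 x := hgx.intervalIntegrable_of_Icc hx.1
  have hgi2 : IntervalIntegrable (fun y => g y ^ 2) volume 0 x :=
    (hgx.pow 2).intervalIntegrable_of_Icc hx.1
  have hftc : ∫ y in (0 : ℝ)..x, g y = v x := by
    rw [intervalIntegral.integral_eq_sub_of_hasDerivAt_of_le hx.1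
      (hv.continuousOn.mono hsub) (fun y hy => ?_) hgi, hv0, sub_zero]
    have hy' : y ∈ Ioo 0 L := ⟨hy.1, hy.2.trans_le hx.2⟩
    exact ((hv.differentiableOn one_ne_zero) y (Ioo_subset_Icc_self hy')).hasDerivWithinAt.hasDerivAt
      (Icc_mem_nhds hy'.1 hy'.2)
  have hmono : ∫ y in (0 : ℝ)..x, g y ^ 2 ≤ ∫ y in Ioo 0 L, g y ^ 2 := by
    rw [intervalIntegral.integral_of_le hx.1, integral_Ioc_eq_integral_Ioo]
    exact setIntegral_mono_set
      (((hgc.pow 2).integrableOn_Icc).mono_set Ioo_subset_Icc_self)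
      (Filter.Eventually.of_forall fun y => sq_nonneg (g y))
      (Ioo_subset_Ioo_right hx.2).eventuallyLE
  have key : ∀ t : ℝ, 2 * t * v x ≤ x * t ^ 2 + ∫ y in (0 : ℝ)..x, g y ^ 2 := by
    intro t
    have h : ∫ y in (0 : ℝ)..x, 2 * t * g y ≤ ∫ y in (0 : ℝ)..x, (t ^ 2 + g y ^ 2) :=
      intervalIntegral.integral_mono_on hx.1 (hgi.const_mul _)
        (intervalIntegrable_const.add hgi2)
        (fun y _ => by nlinarith [sq_nonneg (t - g y)])
    rw [intervalIntegral.integral_const_mul, hftc,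
      intervalIntegral.integral_add intervalIntegrable_const hgi2,
      intervalIntegral.integral_const, sub_zero, smul_eq_mul] at h
    exact h
  have h := key (v x / L)
  have hxt : x * (v x / L) ^ 2 ≤ L * (v x / L) ^ 2 :=
    mul_le_mul_of_nonneg_right hx.2 (sq_nonneg _)
  have h1 : 2 * (v x / L) * v x = 2 * (v x ^ 2 / L) := by ring
  have h2 : L * (v x / L) ^ 2 = v x ^ 2 / L := by field_simp
  have h3 : v x ^ 2 / L ≤ ∫ y in Ioo 0 L, g y ^ 2 := by linarith
  rwa [div_le_iff₀' hL] at h3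

/-- Poincaré inequality on `(0, L)` for `C¹` functions vanishing at `0`. -/
theorem setIntegral_sq_le_mul_setIntegral_derivWithin_sq {L : ℝ} (hL : 0 < L) {v : ℝ → ℝ}
    (hv : ContDiffOn ℝ 1 v (Icc 0 L)) (hv0 : v 0 = 0) :
    ∫ x in Ioo 0 L, v x ^ 2 ≤ L ^ 2 * ∫ y in Ioo 0 L, derivWithin v (Icc 0 L) y ^ 2 := by
  calc ∫ x in Ioo 0 L, v x ^ 2
      ≤ ∫ _ in Ioo 0 L, L * ∫ y in Ioo 0 L, derivWithin v (Icc 0 L) y ^ 2 :=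
        setIntegral_mono_on
          (((hv.continuousOn.pow 2).integrableOn_Icc).mono_set Ioo_subset_Icc_self)
          (integrableOn_const measure_Ioo_lt_top.ne) measurableSet_Ioo
          (fun x hx => sq_le_mul_setIntegral_derivWithin_sq hL hv hv0 (Ioo_subset_Icc_self hx))
    _ = L ^ 2 * ∫ y in Ioo 0 L, derivWithin v (Icc 0 L) y ^ 2 := by
        rw [setIntegral_const, Real.volume_real_Ioo_of_le hL.le, smul_eq_mul]
        ring

/-- The exchange terms of the form combine into the square of the pressure jump. -/
theorem setIntegral_jump_mul_sub {L : ℝ} {u v : ℝ → ℝ}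
    (hu : ContinuousOn u (Icc 0 L)) (hv : ContinuousOn v (Icc 0 L)) :
    (∫ x in Ioo 0 L, (u x - v x) * u x) - (∫ x in Ioo 0 L, (u x - v x) * v x)
      = ∫ x in Ioo 0 L, (u x - v x) ^ 2 := by
  have hi₁ : IntegrableOn (fun x => (u x - v x) * u x) (Ioo 0 L) :=
    (((hu.sub hv).mul hu).integrableOn_Icc).mono_set Ioo_subset_Icc_self
  have hi₂ : IntegrableOn (fun x => (u x - v x) * v x) (Ioo 0 L) :=
    (((hu.sub hv).mul hv).integrableOn_Icc).mono_set Ioo_subset_Icc_self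
  rw [← integral_sub hi₁ hi₂]
  exact integral_congr_ae (Filter.Eventually.of_forall fun x => by ring)

/-- The trace on the interface of a function continuous on the closed upper half is continuous. -/
theorem continuousOn_interface_trace {L Hm : ℝ} (hL : 0 < L) (hH : 0 < Hm) {w : ℝ × ℝ → ℝ}
    (hw : ContinuousOn w (closure (OmegaPlus L Hm))) :
    ContinuousOn (fun x => w (x, 0)) (Icc 0 L) := by
  refine hw.comp (by fun_prop) fun x hx => ?_
  rw [OmegaPlus, closure_prod_eq, closure_Ioo hL.ne, closure_Ioo hH.ne]
  exact ⟨hx, le_rfl, hH.le⟩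

/-- **Identity and coercivity for the CCPF bilinear form.**  There is `c > 0`
depending only on `𝒦`, `D` and `L` (not on `Hₘ`, `α_ex`, `vᵐ`, `v^c`) such that for
all `Hₘ > 0`, `α_ex ≥ 0` and all admissible `(vᵐ, v^c)` (with `vᵐ` continuous on
`closure Ωᵐ`, `C¹` on the closures of `Ω₊` and `Ω₋`, vanishing on `∂Ωᵐ`, and
`v^c ∈ C¹([0,L])` with `v^c(0) = v^c(L) = 0`):
(i)  `a(v,v) = 𝒦 ∫_{Ωᵐ} |∇vᵐ|² + D ∫₀^L ((v^c)')² + α_ex ∫₀^L (vᵐ(x,0) - v^c(x))²`, and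
(ii) `a(v,v) ≥ c (∫_{Ωᵐ} |∇vᵐ|² + ∫₀^L (v^c)² + ∫₀^L ((v^c)')²)`. -/
theorem ccpf_form_identity_and_coercive (𝒦 D L : ℝ)
    (h𝒦 : 0 < 𝒦) (hD : 0 < D) (hL : 0 < L) :
    ∃ c > 0, ∀ Hm : ℝ, 0 < Hm → ∀ α : ℝ, 0 ≤ α →
      ∀ (vm : ℝ × ℝ → ℝ) (vc : ℝ → ℝ),
        ContinuousOn vm (closure (OmegaM L Hm)) →
        ContDiffOn ℝ 1 vm (closure (OmegaPlus L Hm)) →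
        ContDiffOn ℝ 1 vm (closure (OmegaMinus L Hm)) →
        (∀ p ∈ OuterBoundary L Hm, vm p = 0) →
        ContDiffOn ℝ 1 vc (Icc 0 L) → vc 0 = 0 → vc L = 0 →
        (aQuad 𝒦 D L Hm α vm vc
            = 𝒦 * (∫ p in OmegaM L Hm, gradSq vm p)
              + D * (∫ x in Ioo (0 : ℝ) L, (derivWithin vc (Icc 0 L) x) ^ 2)
              + α * (∫ x in Ioo (0 : ℝ) L, (vm (x, 0) - vc x) ^ 2))
          ∧ aQuad 𝒦 D L Hm α vm vc
            ≥ c * ((∫ p in OmegaM L Hm, gradSq vm p)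
                + (∫ x in Ioo (0 : ℝ) L, (vc x) ^ 2)
                + ∫ x in Ioo (0 : ℝ) L, (derivWithin vc (Icc 0 L) x) ^ 2) := by
  refine ⟨min 𝒦 (D / (1 + L ^ 2)), lt_min h𝒦 (by positivity), ?_⟩
  intro Hm hHm α hα vm vc _ hplus _ _ hvc hvc0 _
  have hid : aQuad 𝒦 D L Hm α vm vc
      = 𝒦 * (∫ p in OmegaM L Hm, gradSq vm p)
        + D * (∫ x in Ioo (0 : ℝ) L, (derivWithin vc (Icc 0 L) x) ^ 2)
        + α * (∫ x in Ioo (0 : ℝ) L, (vm (x, 0) - vc x) ^ 2) := by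
    rw [aQuad, ← setIntegral_jump_mul_sub
      (continuousOn_interface_trace hL hHm hplus.continuousOn) hvc.continuousOn]
    ring
  refine ⟨hid, ?_⟩
  rw [hid]
  have hG : 0 ≤ ∫ p in OmegaM L Hm, gradSq vm p :=
    integral_nonneg fun p => by unfold gradSq; positivity
  have hJ : 0 ≤ α * ∫ x in Ioo (0 : ℝ) L, (vm (x, 0) - vc x) ^ 2 :=
    mul_nonneg hα (integral_nonneg fun x => sq_nonneg _)
  have hS : 0 ≤ ∫ x in Ioo (0 : ℝ) L, vc x ^ 2 := integral_nonneg fun x => sq_nonneg _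
  have hT : 0 ≤ ∫ x in Ioo (0 : ℝ) L, derivWithin vc (Icc 0 L) x ^ 2 :=
    integral_nonneg fun x => sq_nonneg _
  have hP := setIntegral_sq_le_mul_setIntegral_derivWithin_sq hL hvc hvc0
  set G := ∫ p in OmegaM L Hm, gradSq vm p
  set S := ∫ x in Ioo (0 : ℝ) L, vc x ^ 2
  set T := ∫ x in Ioo (0 : ℝ) L, derivWithin vc (Icc 0 L) x ^ 2
  have h1 : min 𝒦 (D / (1 + L ^ 2)) * G ≤ 𝒦 * G :=
    mul_le_mul_of_nonneg_right (min_le_left _ _) hG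
  have h2 : min 𝒦 (D / (1 + L ^ 2)) * (S + T) ≤ D * T :=
    calc min 𝒦 (D / (1 + L ^ 2)) * (S + T)
        ≤ D / (1 + L ^ 2) * (S + T) :=
          mul_le_mul_of_nonneg_right (min_le_right _ _) (add_nonneg hS hT)
      _ ≤ D / (1 + L ^ 2) * ((1 + L ^ 2) * T) := by
          gcongr
          linarith
      _ = D * T := by field_simp
  linarith

end
end

section
/- Let T = {(x,y) ∈ ℝ² : x > 0, y > 0, x + y < 1} be the open reference triangle and b_T(x,y) = 27 x y (1 − x − y) the element bubble function. For every k ∈ ℕ there exists a constant c(k) > 0 such that for every real polynomial v in two variables of total degree at most k: c(k) ∫_T v² dx dy ≤ ∫_T v² b_T dx dy ≤ ∫_T v² dx dy. -/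
open MeasureTheory Set

noncomputable section

/-- The open reference triangle `T = {(x,y) : x > 0, y > 0, x + y < 1}`. -/
def refTriangle : Set (ℝ × ℝ) := {p | 0 < p.1 ∧ 0 < p.2 ∧ p.1 + p.2 < 1}

/-- The element bubble function `b_T(x,y) = 27 x y (1 - x - y)` of the reference
triangle. -/
def bubbleT (p : ℝ × ℝ) : ℝ := 27 * p.1 * p.2 * (1 - p.1 - p.2)

theorem exists_pos_mul_apply_self_le_norm {E : Type*} [NormedAddCommGroup E] [NormedSpace ℝ E]
    [FiniteDimensional ℝ E] (A : E →ₗ[ℝ] E →ₗ[ℝ] ℝ) :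
    ∃ c > 0, ∀ x, c * A x x ≤ ‖x‖ * ‖x‖ := by
  let A' := A.toContinuousBilinearMap
  refine ⟨(‖A'‖ + 1)⁻¹, by positivity, fun x => ?_⟩
  rw [inv_mul_le_iff₀ (by positivity)]
  calc A x x ≤ ‖A' x x‖ := le_abs_self _
    _ ≤ ‖A'‖ * ‖x‖ * ‖x‖ := A'.le_opNorm₂ x x
    _ ≤ (‖A'‖ + 1) * (‖x‖ * ‖x‖) := by nlinarith [mul_self_nonneg ‖x‖]

/-- A bilinear form on a finite-dimensional real space is dominated on the diagonal by any
positive definite symmetric bilinear form. -/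
theorem exists_pos_mul_apply_self_le {E : Type*} [AddCommGroup E] [Module ℝ E]
    [FiniteDimensional ℝ E] (A B : E →ₗ[ℝ] E →ₗ[ℝ] ℝ) (hsymm : ∀ x y, B y x = B x y)
    (hnonneg : ∀ x, 0 ≤ B x x) (hdef : ∀ x, B x x = 0 → x = 0) :
    ∃ c > 0, ∀ x, c * A x x ≤ B x x := by
  let core : InnerProductSpace.Core ℝ E :=
    { inner := fun x y => B x y
      conj_inner_symm := fun x y => by simpa using hsymm x y
      re_inner_nonneg := fun x => by simpa using hnonneg x
      add_left := fun x y z => by simp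
      smul_left := fun x y r => by simp
      definite := hdef }
  let : NormedAddCommGroup E := core.toNormedAddCommGroup
  let : InnerProductSpace ℝ E := InnerProductSpace.ofCore core.toCore
  have hB (x : E) : ‖x‖ * ‖x‖ = B x x := (real_inner_self_eq_norm_mul_norm x).symm
  obtain ⟨c, hc, h⟩ := exists_pos_mul_apply_self_le_norm A
  exact ⟨c, hc, fun x => (h x).trans_eq (hB x)⟩

theorem isOpen_refTriangle : IsOpen refTriangle :=
  (isOpen_lt continuous_const continuous_fst).inter
    ((isOpen_lt continuous_const continuous_snd).inter
      (isOpen_lt (continuous_fst.add continuous_snd) continuous_const))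

theorem measurableSet_refTriangle : MeasurableSet refTriangle :=
  isOpen_refTriangle.measurableSet

theorem refTriangle_subset_Icc : refTriangle ⊆ Icc (0, 0) (1, 1) := by
  rintro ⟨x, y⟩ ⟨hx, hy, hxy⟩
  simp only at hx hy hxy
  exact ⟨⟨hx.le, hy.le⟩, ⟨by linarith, by linarith⟩⟩

theorem Continuous.integrableOn_refTriangle {f : ℝ × ℝ → ℝ} (hf : Continuous f) :
    IntegrableOn f refTriangle :=
  (hf.continuousOn.integrableOn_compact isCompact_Icc).mono_set refTriangle_subset_Icc

theorem continuous_bubbleT : Continuous bubbleT := by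
  unfold bubbleT
  fun_prop

theorem bubbleT_pos {p : ℝ × ℝ} (hp : p ∈ refTriangle) : 0 < bubbleT p := by
  obtain ⟨hx, hy, hxy⟩ := hp
  have hz : 0 < 1 - p.1 - p.2 := by linarith
  unfold bubbleT
  positivity

theorem bubbleT_le_one {p : ℝ × ℝ} (hp : p ∈ refTriangle) : bubbleT p ≤ 1 := by
  obtain ⟨x, y⟩ := p
  obtain ⟨hx, hy, hxy⟩ := hp
  simp only [bubbleT] at *
  nlinarith [mul_nonneg hx.le (sq_nonneg (y - (1 - x - y))),
    mul_nonneg hy.le (sq_nonneg (x - (1 - x - y))),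
    mul_nonneg (sub_pos.2 hxy).le (sq_nonneg (x - y)),
    sq_nonneg (x - y), sq_nonneg (y - (1 - x - y)), sq_nonneg (x - (1 - x - y))]

theorem continuous_eval_pair (v : MvPolynomial (Fin 2) ℝ) :
    Continuous fun p : ℝ × ℝ => MvPolynomial.eval ![p.1, p.2] v := by
  refine (MvPolynomial.continuous_eval v).comp (continuous_pi fun i => ?_)
  fin_cases i
  · exact continuous_fst
  · exact continuous_snd

theorem MvPolynomial.eq_zero_of_eqOn_refTriangle {v : MvPolynomial (Fin 2) ℝ}
    (h : ∀ p ∈ refTriangle, MvPolynomial.eval ![p.1, p.2] v = 0) : v = 0 := by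
  refine MvPolynomial.funext_set (fun _ => Ioo (0 : ℝ) (1 / 2))
    (fun _ => Ioo_infinite (by norm_num)) fun x hx => ?_
  have h0 := hx 0 (mem_univ _)
  have h1 := hx 1 (mem_univ _)
  have hT : (x 0, x 1) ∈ refTriangle := ⟨h0.1, h1.1, by linarith [h0.2, h1.2]⟩
  have hx' : ![x 0, x 1] = x := by
    ext i
    fin_cases i <;> rfl
  simpa [hx'] using h _ hT

/-- The bilinear form `(u, v) ↦ ∫_T u v w` on bivariate polynomials of total degree at most `k`. -/
def weightedForm (k : ℕ) (w : ℝ × ℝ → ℝ) (hw : Continuous w) :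
    MvPolynomial.restrictTotalDegree (Fin 2) ℝ k →ₗ[ℝ]
      MvPolynomial.restrictTotalDegree (Fin 2) ℝ k →ₗ[ℝ] ℝ :=
  have hint (u v : MvPolynomial (Fin 2) ℝ) : IntegrableOn (fun p : ℝ × ℝ =>
      MvPolynomial.eval ![p.1, p.2] u * MvPolynomial.eval ![p.1, p.2] v * w p) refTriangle :=
    (((continuous_eval_pair u).mul (continuous_eval_pair v)).mul hw).integrableOn_refTriangle
  LinearMap.mk₂ ℝ
    (fun u v => ∫ p in refTriangle,
      MvPolynomial.eval ![p.1, p.2] u.1 * MvPolynomial.eval ![p.1, p.2] v.1 * w p)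
    (fun u₁ u₂ v => by
      rw [← integral_add (hint _ _) (hint _ _)]
      simp [add_mul])
    (fun c u v => by
      rw [smul_eq_mul, ← integral_const_mul]
      simp [mul_assoc])
    (fun u v₁ v₂ => by
      rw [← integral_add (hint _ _) (hint _ _)]
      simp [add_mul, mul_add])
    (fun c u v => by
      rw [smul_eq_mul, ← integral_const_mul]
      simp [mul_assoc, mul_left_comm])

theorem weightedForm_apply_self (k : ℕ) (w : ℝ × ℝ → ℝ) (hw : Continuous w)
    (v : MvPolynomial.restrictTotalDegree (Fin 2) ℝ k) :
    weightedForm k w hw v v =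
      ∫ p in refTriangle, (MvPolynomial.eval ![p.1, p.2] v.1) ^ 2 * w p := by
  simp [weightedForm, sq]

/-- **Bubble-weighted `L²` equivalence on the reference triangle** (inequality (I1)
on the reference element).  For every `k` there is `c(k) > 0` such that for every
polynomial `v` in two variables of total degree at most `k`,
`c(k) ∫_T v² ≤ ∫_T v² b_T ≤ ∫_T v²`. -/
theorem bubble_L2_equiv_triangle (k : ℕ) :
    ∃ c > 0, ∀ v : MvPolynomial (Fin 2) ℝ, v.totalDegree ≤ k →
      c * (∫ p in refTriangle, (MvPolynomial.eval ![p.1, p.2] v) ^ 2)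
          ≤ (∫ p in refTriangle, (MvPolynomial.eval ![p.1, p.2] v) ^ 2 * bubbleT p)
        ∧ (∫ p in refTriangle, (MvPolynomial.eval ![p.1, p.2] v) ^ 2 * bubbleT p)
          ≤ ∫ p in refTriangle, (MvPolynomial.eval ![p.1, p.2] v) ^ 2 := by
  have hle (p) (hp : p ∈ refTriangle) := (bubbleT_pos hp).le
  have hint (v : MvPolynomial (Fin 2) ℝ) : IntegrableOn (fun p : ℝ × ℝ =>
      (MvPolynomial.eval ![p.1, p.2] v) ^ 2 * bubbleT p) refTriangle :=
    (((continuous_eval_pair v).pow 2).mul continuous_bubbleT).integrableOn_refTriangle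
  obtain ⟨c, hc, h⟩ := exists_pos_mul_apply_self_le
    (weightedForm k (fun _ => 1) continuous_const) (weightedForm k bubbleT continuous_bubbleT)
    (fun u v => by simp [weightedForm, mul_comm])
    (fun v => by
      rw [weightedForm_apply_self]
      exact setIntegral_nonneg measurableSet_refTriangle fun p hp =>
        mul_nonneg (sq_nonneg _) (hle p hp))
    (fun v hv => by
      rw [weightedForm_apply_self, setIntegral_eq_zero_iff_of_nonneg_ae
        (ae_restrict_of_forall_mem measurableSet_refTriangle fun p hp =>
          mul_nonneg (sq_nonneg _) (hle p hp)) (hint _)] at hv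
      have hz := Measure.eqOn_open_of_ae_eq hv isOpen_refTriangle
        (((continuous_eval_pair _).pow 2).mul continuous_bubbleT).continuousOn continuousOn_const
      refine Subtype.ext (MvPolynomial.eq_zero_of_eqOn_refTriangle fun p hp => ?_)
      simpa [(bubbleT_pos hp).ne'] using hz hp)
  refine ⟨c, hc, fun v hv => ⟨?_, ?_⟩⟩
  · simpa [weightedForm_apply_self] using
      h ⟨v, (MvPolynomial.mem_restrictTotalDegree _ _ _).2 hv⟩
  · exact setIntegral_mono_on (hint v) ((continuous_eval_pair v).pow 2).integrableOn_refTriangle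
      measurableSet_refTriangle fun p hp =>
        mul_le_of_le_one_right (sq_nonneg _) (bubbleT_le_one hp)

end
end

section
/- For h₁ > 0, let e(x) = 4 (x/h₁)(1 − x/h₁) on (0,h₁). For every k ∈ ℕ there exists a constant c(k) > 0, independent of h₁, such that for every real polynomial v in one variable of degree at most k: c(k) ∫₀^{h₁} v(x)² dx ≤ ∫₀^{h₁} v(x)² e(x) dx ≤ ∫₀^{h₁} v(x)² dx. -/
open MeasureTheory Set

noncomputable section

/-- On a finite-dimensional space, a continuous function that is homogeneous of degree two and
positive away from the origin dominates a multiple of any other such homogeneous function. -/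
theorem exists_pos_mul_le_of_homogeneous {E : Type*} [NormedAddCommGroup E] [NormedSpace ℝ E]
    [FiniteDimensional ℝ E] {F G : E → ℝ} (hF : Continuous F) (hG : Continuous G)
    (hF2 : ∀ (t : ℝ) a, F (t • a) = t ^ 2 * F a) (hG2 : ∀ (t : ℝ) a, G (t • a) = t ^ 2 * G a)
    (hpos : ∀ a, a ≠ 0 → 0 < F a) : ∃ c > (0 : ℝ), ∀ a, c * G a ≤ F a := by
  have : ProperSpace E := FiniteDimensional.proper ℝ E
  have hS : IsCompact (Metric.sphere (0 : E) 1) := isCompact_sphere 0 1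
  obtain ⟨m, hm, hmF⟩ := hS.exists_forall_le' hF.continuousOn (a := (0 : ℝ)) fun a ha =>
    hpos a (ne_zero_of_mem_unit_sphere ⟨a, ha⟩)
  obtain ⟨M, hM⟩ := hS.exists_bound_of_continuousOn hG.continuousOn
  have hMpos : 0 < |M| + 1 := by positivity
  refine ⟨m / (|M| + 1), by positivity, fun a => ?_⟩
  rcases eq_or_ne a 0 with rfl | ha
  · have h1 := hF2 0 0
    have h2 := hG2 0 0
    simp only [smul_zero] at h1 h2
    norm_num at h1 h2
    simp [h1, h2]
  · have hb : ‖a‖⁻¹ • a ∈ Metric.sphere (0 : E) 1 := by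
      simp [norm_smul, norm_ne_zero_iff.mpr ha]
    have hab : a = ‖a‖ • (‖a‖⁻¹ • a) := by
      rw [smul_smul, mul_inv_cancel₀ (norm_ne_zero_iff.mpr ha), one_smul]
    have hFb := hmF _ hb
    have hGb : G (‖a‖⁻¹ • a) ≤ |M| + 1 :=
      (le_abs_self _).trans ((hM _ hb).trans ((le_abs_self M).trans (by linarith)))
    rw [hab, hF2, hG2, mul_left_comm]
    refine mul_le_mul_of_nonneg_left (le_trans ?_ hFb) (sq_nonneg _)
    calc m / (|M| + 1) * G (‖a‖⁻¹ • a) ≤ m / (|M| + 1) * (|M| + 1) := by gcongr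
      _ = m := div_mul_cancel₀ _ hMpos.ne'

/-- A nonzero real polynomial does not vanish identically on the open unit interval. -/
theorem Polynomial.exists_mem_Ioo_eval_ne_zero {p : Polynomial ℝ} (hp : p ≠ 0) :
    ∃ x ∈ Ioo (0 : ℝ) 1, p.eval x ≠ 0 := by
  by_contra! h
  exact hp (p.eq_zero_of_infinite_isRoot ((Ioo_infinite one_pos).mono h))

/-- The bubble-weighted `L²` norm controls the `L²` norm on the unit interval, uniformly over
polynomials of bounded degree. -/
theorem exists_pos_mul_integral_sq_le_bubble (k : ℕ) :
    ∃ c > (0 : ℝ), ∀ v : Polynomial ℝ, v.natDegree ≤ k →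
      c * (∫ x in (0 : ℝ)..1, (v.eval x) ^ 2)
        ≤ ∫ x in (0 : ℝ)..1, (v.eval x) ^ 2 * (4 * x * (1 - x)) := by
  let P : (Fin (k + 1) → ℝ) → ℝ → ℝ := fun a x => ∑ i, a i * x ^ (i : ℕ)
  have hP : ∀ (t : ℝ) a x, P (t • a) x = t * P a x := fun t a x => by
    simp [P, Finset.mul_sum, mul_assoc]
  have hcoeff : ∀ v : Polynomial ℝ, v.natDegree ≤ k → ∀ x,
      v.eval x = P (fun i => v.coeff i) x := fun v hv x => by
    rw [Polynomial.eval_eq_sum_range' (Nat.lt_succ_of_le hv), Finset.sum_range]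
  obtain ⟨c, hc, h⟩ := exists_pos_mul_le_of_homogeneous
    (F := fun a => ∫ x in (0 : ℝ)..1, (P a x) ^ 2 * (4 * x * (1 - x)))
    (G := fun a => ∫ x in (0 : ℝ)..1, (P a x) ^ 2)
    (intervalIntegral.continuous_parametric_intervalIntegral_of_continuous' (by
      simp only [P, Function.uncurry_def]; fun_prop) 0 1)
    (intervalIntegral.continuous_parametric_intervalIntegral_of_continuous' (by
      simp only [P, Function.uncurry_def]; fun_prop) 0 1)
    (fun t a => by
      simp only [hP, mul_pow, mul_assoc, intervalIntegral.integral_const_mul])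
    (fun t a => by
      simp only [hP, mul_pow, intervalIntegral.integral_const_mul])
    (fun a ha => by
      let p : Polynomial ℝ := ∑ i : Fin (k + 1), Polynomial.monomial (i : ℕ) (a i)
      have hpP : ∀ x, p.eval x = P a x := fun x => by
        simp [p, P, Polynomial.eval_finsetSum]
      have hp : p ≠ 0 := fun h0 => ha <| funext fun i => by
        have := congrArg (fun q => Polynomial.coeff q (i : ℕ)) h0
        simpa [p, Polynomial.finsetSum_coeff, Polynomial.coeff_monomial, Fin.val_inj] using this
      obtain ⟨x, hx, hpx⟩ := Polynomial.exists_mem_Ioo_eval_ne_zero hp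
      rw [hpP] at hpx
      refine intervalIntegral.integral_pos one_pos (by simp only [P]; fun_prop) ?_
        ⟨x, Ioo_subset_Icc_self hx, ?_⟩
      · intro y hy
        have h1 := hy.1.le
        have h2 := sub_nonneg.mpr hy.2
        positivity
      · have h1 := hx.1
        have h2 := sub_pos.mpr hx.2
        positivity)
  refine ⟨c, hc, fun v hv => ?_⟩
  simp only [hcoeff v hv]
  exact h _

/-- **Edge-bubble-weighted `L²` equivalence on an edge** (inequality (I3)).  For the
edge bubble `e(x) = 4 (x/h₁)(1 - x/h₁)` on `(0,h₁)` and every `k` there is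
`c(k) > 0`, independent of `h₁`, such that for every polynomial `v` in one variable
of degree at most `k`, `c(k) ∫₀^{h₁} v² ≤ ∫₀^{h₁} v² e ≤ ∫₀^{h₁} v²`. -/
theorem edge_bubble_L2_equiv (k : ℕ) :
    ∃ c > 0, ∀ h₁ : ℝ, 0 < h₁ →
      ∀ v : Polynomial ℝ, v.natDegree ≤ k →
        c * (∫ x in Ioo (0 : ℝ) h₁, (v.eval x) ^ 2)
            ≤ (∫ x in Ioo (0 : ℝ) h₁, (v.eval x) ^ 2 * (4 * (x / h₁) * (1 - x / h₁)))
          ∧ (∫ x in Ioo (0 : ℝ) h₁, (v.eval x) ^ 2 * (4 * (x / h₁) * (1 - x / h₁)))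
            ≤ ∫ x in Ioo (0 : ℝ) h₁, (v.eval x) ^ 2 := by
  obtain ⟨c, hc, hcv⟩ := exists_pos_mul_integral_sq_le_bubble k
  refine ⟨c, hc, fun h hh v hv => ⟨?_, ?_⟩⟩
  · simp only [← integral_Ioc_eq_integral_Ioo, ← intervalIntegral.integral_of_le hh.le]
    have hdeg : (v.comp (Polynomial.C h * Polynomial.X)).natDegree ≤ k := by
      rw [Polynomial.natDegree_comp, Polynomial.natDegree_C_mul_X h hh.ne', mul_one]
      exact hv
    have key := mul_le_mul_of_nonneg_left (hcv _ hdeg) hh.le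
    have e1 := intervalIntegral.smul_integral_comp_mul_left (a := 0) (b := 1)
      (fun x => (v.eval x) ^ 2) h
    have e2 := intervalIntegral.smul_integral_comp_mul_left (a := 0) (b := 1)
      (fun x => (v.eval x) ^ 2 * (4 * (x / h) * (1 - x / h))) h
    simp only [mul_zero, mul_one, smul_eq_mul, mul_div_cancel_left₀ _ hh.ne'] at e1 e2
    simp only [Polynomial.eval_comp, Polynomial.eval_mul, Polynomial.eval_C,
      Polynomial.eval_X] at key
    rw [← e1, ← e2, mul_left_comm]
    exact key
  · have hint : ∀ f : ℝ → ℝ, Continuous f → IntegrableOn f (Ioo 0 h) := fun f hf =>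
      (hf.integrableOn_Icc (a := 0) (b := h)).mono_set Ioo_subset_Icc_self
    refine setIntegral_mono_on (hint _ (by fun_prop)) (hint _ (by fun_prop))
      measurableSet_Ioo fun x _ => ?_
    refine mul_le_of_le_one_right (sq_nonneg _) ?_
    nlinarith [sq_nonneg (2 * (x / h) - 1)]

end
end

section
/- For h₁, h₂ with 0 < h₂ ≤ h₁, let R = (0,h₁)×(0,h₂), let E = (0,h₁)×{0} be its bottom edge, and let b_E(x,y) = 4 (x/h₁)(1 − x/h₁)(1 − y/h₂) be the edge bubble function associated with E. For every k ∈ ℕ there exists a constant C(k) > 0, independent of h₁ and h₂, such that for every real polynomial v in one variable of degree at most k: ∫_R ( v(x) · b_E(x,y) )² dx dy ≤ C(k) h₂ ∫₀^{h₁} v(x)² dx. -/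
open MeasureTheory Set

noncomputable section

/-- The open anisotropic rectangle `R = (0,h₁) × (0,h₂)`. -/
def refRect (h₁ h₂ : ℝ) : Set (ℝ × ℝ) := Ioo 0 h₁ ×ˢ Ioo 0 h₂

/-- The edge bubble function `b_E(x,y) = 4 (x/h₁)(1 - x/h₁)(1 - y/h₂)` associated
with the bottom edge `E = (0,h₁) × {0}` of the rectangle `R = (0,h₁) × (0,h₂)`. -/
def edgeBubble (h₁ h₂ : ℝ) (p : ℝ × ℝ) : ℝ :=
  4 * (p.1 / h₁) * (1 - p.1 / h₁) * (1 - p.2 / h₂)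

lemma edgeBubble_sq_le_one {h₁ h₂ : ℝ} {p : ℝ × ℝ} (hp : p ∈ refRect h₁ h₂) :
    edgeBubble h₁ h₂ p ^ 2 ≤ 1 := by
  obtain ⟨⟨hx, hx'⟩, hy, hy'⟩ := hp
  have hs : 4 * (p.1 / h₁) * (1 - p.1 / h₁) ≤ 1 := by
    nlinarith [sq_nonneg (2 * (p.1 / h₁) - 1)]
  have hs₀ : 0 ≤ 4 * (p.1 / h₁) * (1 - p.1 / h₁) :=
    mul_nonneg (by have := hx.trans hx'; positivity)
      (sub_nonneg.2 (div_le_one_of_le₀ hx'.le (hx.trans hx').le))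
  have ht₀ : 0 ≤ 1 - p.2 / h₂ :=
    sub_nonneg.2 (div_le_one_of_le₀ hy'.le (hy.trans hy').le)
  have ht : 1 - p.2 / h₂ ≤ 1 :=
    sub_le_self _ (div_nonneg hy.le (hy.trans hy').le)
  exact pow_le_one₀ (mul_nonneg hs₀ ht₀) (mul_le_one₀ hs ht₀ ht)

lemma continuous_edgeBubble (h₁ h₂ : ℝ) : Continuous (edgeBubble h₁ h₂) := by
  unfold edgeBubble
  fun_prop

lemma Continuous.integrableOn_refRect {f : ℝ × ℝ → ℝ} (hf : Continuous f) (h₁ h₂ : ℝ) :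
    IntegrableOn f (refRect h₁ h₂) :=
  (hf.continuousOn.integrableOn_compact (isCompact_Icc.prod isCompact_Icc)).mono_set
    (prod_mono Ioo_subset_Icc_self Ioo_subset_Icc_self)

lemma setIntegral_refRect_comp_fst (f : ℝ → ℝ) (h₁ : ℝ) {h₂ : ℝ} (h : 0 ≤ h₂) :
    ∫ p in refRect h₁ h₂, f p.1 = h₂ * ∫ x in Ioo 0 h₁, f x := by
  have := setIntegral_prod_mul (μ := volume) (ν := volume) f (fun _ : ℝ ↦ (1 : ℝ))
    (Ioo 0 h₁) (Ioo 0 h₂)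
  simpa [refRect, ← Measure.volume_eq_prod, h, mul_comm] using this

/-- **Bound for the extended edge bubble on an anisotropic rectangle** (inequality
(I4)).  For every `k` there is `C(k) > 0`, independent of `h₁` and `h₂`, such that for
all `0 < h₂ ≤ h₁` and every polynomial `v` in one variable of degree at most `k`,
`∫_R (v(x) b_E(x,y))² dx dy ≤ C(k) h₂ ∫₀^{h₁} v(x)² dx`. -/
theorem edge_bubble_extension_bound (k : ℕ) :
    ∃ C > 0, ∀ h₁ h₂ : ℝ, 0 < h₂ → h₂ ≤ h₁ →
      ∀ v : Polynomial ℝ, v.natDegree ≤ k →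
        (∫ p in refRect h₁ h₂, (v.eval p.1 * edgeBubble h₁ h₂ p) ^ 2)
          ≤ C * h₂ * ∫ x in Ioo (0 : ℝ) h₁, (v.eval x) ^ 2 := by
  refine ⟨1, one_pos, fun h₁ h₂ hh₂ _ v _ ↦ ?_⟩
  rw [one_mul, ← setIntegral_refRect_comp_fst (fun x ↦ v.eval x ^ 2) h₁ hh₂.le]
  have hv : Continuous fun p : ℝ × ℝ ↦ v.eval p.1 := v.continuous.comp continuous_fst
  refine setIntegral_mono_on
    (((hv.mul (continuous_edgeBubble h₁ h₂)).pow 2).integrableOn_refRect h₁ h₂)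
    ((hv.pow 2).integrableOn_refRect h₁ h₂)
    (measurableSet_Ioo.prod measurableSet_Ioo) fun p hp ↦ ?_
  rw [mul_pow]
  exact mul_le_of_le_one_right (sq_nonneg _) (edgeBubble_sq_le_one hp)

end
end

section
/- Let K̄ = (0,1)² with edges Ē₁ = (0,1)×{0}, Ē₂ = (0,1)×{1}, Ē₃ = {0}×(0,1), Ē₄ = {1}×(0,1), and let Q̄^{1+} := span{1, x, y, xy, y²}, a five-dimensional space of polynomials. Define the functionals θ̄ᵢ(q) := ∫_{Ēᵢ} q ds for i = 1,…,4 and θ̄₅(q) := ∫_{K̄} 3(2x−1)(2y−1) q(x,y) dx dy. Then the linear map Q̄^{1+} → ℝ⁵, q ↦ (θ̄₁(q), θ̄₂(q), θ̄₃(q), θ̄₄(q), θ̄₅(q)), is a linear isomorphism; equivalently, the triplet (K̄, Q̄^{1+}, {θ̄ᵢ}ᵢ₌₁⁵) is a finite element. -/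
open MeasureTheory Set

noncomputable section

/-- The polynomial `q(x,y) = a₀ + a₁ x + a₂ y + a₃ x y + a₄ y²` of the local space
`Q̄^{1+} = span{1, x, y, xy, y²}` with coefficient vector `a`. -/
def q1plusPoly (a : Fin 5 → ℝ) (p : ℝ × ℝ) : ℝ :=
  a 0 + a 1 * p.1 + a 2 * p.2 + a 3 * (p.1 * p.2) + a 4 * p.2 ^ 2

/-- The five degrees of freedom of the modified Crouzeix–Raviart element of type II on
the reference square `K̄ = (0,1)²`: the integrals over the four edges
`Ē₁ = (0,1)×{0}`, `Ē₂ = (0,1)×{1}`, `Ē₃ = {0}×(0,1)`, `Ē₄ = {1}×(0,1)`, and the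
weighted volume moment against `q̄₅(x,y) = 3(2x-1)(2y-1)`. -/
def q1plusDof (a : Fin 5 → ℝ) : Fin 5 → ℝ :=
  ![∫ x in Ioo (0 : ℝ) 1, q1plusPoly a (x, 0),
    ∫ x in Ioo (0 : ℝ) 1, q1plusPoly a (x, 1),
    ∫ y in Ioo (0 : ℝ) 1, q1plusPoly a (0, y),
    ∫ y in Ioo (0 : ℝ) 1, q1plusPoly a (1, y),
    ∫ p in Ioo (0 : ℝ) 1 ×ˢ Ioo (0 : ℝ) 1, 3 * (2 * p.1 - 1) * (2 * p.2 - 1) * q1plusPoly a p]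

lemma integral_Ioo_cubic (c₀ c₁ c₂ c₃ : ℝ) :
    ∫ x in Ioo (0 : ℝ) 1, (c₀ + c₁ * x + c₂ * x ^ 2 + c₃ * x ^ 3) =
      c₀ + c₁ / 2 + c₂ / 3 + c₃ / 4 := by
  rw [← integral_Ioc_eq_integral_Ioo, ← intervalIntegral.integral_of_le zero_le_one]
  have hderiv : ∀ x ∈ uIcc (0 : ℝ) 1,
      HasDerivAt (fun x : ℝ => c₀ * x + c₁ / 2 * x ^ 2 + c₂ / 3 * x ^ 3 + c₃ / 4 * x ^ 4)
        (c₀ + c₁ * x + c₂ * x ^ 2 + c₃ * x ^ 3) x := by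
    intro x _
    refine (((((hasDerivAt_id x).const_mul c₀).add ((hasDerivAt_pow 2 x).const_mul (c₁ / 2))).add
      ((hasDerivAt_pow 3 x).const_mul (c₂ / 3))).add
      ((hasDerivAt_pow 4 x).const_mul (c₃ / 4))).congr_deriv ?_
    norm_num
    ring
  rw [intervalIntegral.integral_eq_sub_of_hasDerivAt hderiv
    (Continuous.intervalIntegrable (by fun_prop) _ _)]
  ring

lemma integral_Ioo_of_eq_cubic {f : ℝ → ℝ} (c₀ c₁ c₂ c₃ : ℝ)
    (hf : ∀ x, f x = c₀ + c₁ * x + c₂ * x ^ 2 + c₃ * x ^ 3) :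
    ∫ x in Ioo (0 : ℝ) 1, f x = c₀ + c₁ / 2 + c₂ / 3 + c₃ / 4 := by
  rw [funext hf, integral_Ioo_cubic]

lemma integral_unitSquare_q1plusPoly (a : Fin 5 → ℝ) :
    ∫ p in Ioo (0 : ℝ) 1 ×ˢ Ioo (0 : ℝ) 1,
      3 * (2 * p.1 - 1) * (2 * p.2 - 1) * q1plusPoly a p = a 3 / 12 := by
  have hcont : Continuous fun p : ℝ × ℝ =>
      3 * (2 * p.1 - 1) * (2 * p.2 - 1) * q1plusPoly a p := by
    unfold q1plusPoly
    fun_prop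
  have hintegrable : IntegrableOn (fun p : ℝ × ℝ =>
      3 * (2 * p.1 - 1) * (2 * p.2 - 1) * q1plusPoly a p) (Ioo (0 : ℝ) 1 ×ˢ Ioo (0 : ℝ) 1) :=
    (hcont.continuousOn.integrableOn_compact
      (isCompact_Icc.prod isCompact_Icc : IsCompact (Icc (0 : ℝ) 1 ×ˢ Icc (0 : ℝ) 1))).mono_set
      (prod_mono Ioo_subset_Icc_self Ioo_subset_Icc_self)
  have hinner : ∀ x : ℝ, ∫ y in Ioo (0 : ℝ) 1,
      3 * (2 * x - 1) * (2 * y - 1) * q1plusPoly a (x, y) =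
        3 * (2 * x - 1) * ((a 2 + a 3 * x + a 4) / 6) := by
    intro x
    rw [integral_Ioo_of_eq_cubic
      (-(3 * (2 * x - 1) * (a 0 + a 1 * x)))
      (3 * (2 * x - 1) * (2 * (a 0 + a 1 * x) - (a 2 + a 3 * x)))
      (3 * (2 * x - 1) * (2 * (a 2 + a 3 * x) - a 4))
      (3 * (2 * x - 1) * (2 * a 4))
      (fun y => by simp only [q1plusPoly]; ring)]
    ring
  rw [Measure.volume_eq_prod] at hintegrable ⊢
  rw [setIntegral_prod _ hintegrable]
  simp only [hinner]
  rw [integral_Ioo_of_eq_cubic (-(a 2 + a 4) / 2) (a 2 + a 4 - a 3 / 2) (a 3) 0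
    (fun x => by ring)]
  ring

lemma q1plusDof_eq (a : Fin 5 → ℝ) :
    q1plusDof a =
      ![a 0 + a 1 / 2, a 0 + a 1 / 2 + a 2 + a 3 / 2 + a 4, a 0 + a 2 / 2 + a 4 / 3,
        a 0 + a 1 + a 2 / 2 + a 3 / 2 + a 4 / 3, a 3 / 12] := by
  unfold q1plusDof
  rw [integral_unitSquare_q1plusPoly,
    integral_Ioo_of_eq_cubic (a 0) (a 1) 0 0 (fun x => by simp only [q1plusPoly]; ring),
    integral_Ioo_of_eq_cubic (a 0 + a 2 + a 4) (a 1 + a 3) 0 0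
      (fun x => by simp only [q1plusPoly]; ring),
    integral_Ioo_of_eq_cubic (a 0) (a 2) (a 4) 0 (fun y => by simp only [q1plusPoly]; ring),
    integral_Ioo_of_eq_cubic (a 0 + a 1) (a 2 + a 3) (a 4) 0
      (fun y => by simp only [q1plusPoly]; ring)]
  ext i
  fin_cases i <;> simp <;> ring

/-- The coefficients of the element of `Q̄^{1+}` with prescribed degrees of freedom `t`. -/
def q1plusInterp (t : Fin 5 → ℝ) : Fin 5 → ℝ :=
  ![t 0 - (t 3 - t 2) / 2 + 3 * t 4,
    t 3 - t 2 - 6 * t 4,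
    3 * t 2 + 3 * t 3 - 4 * t 0 - 2 * t 1 - 6 * t 4,
    12 * t 4,
    3 * t 0 + 3 * t 1 - 3 * t 2 - 3 * t 3]

/-- **Unisolvence of the modified Crouzeix–Raviart element of type II.**  The linear
map from the five-dimensional space `Q̄^{1+} = span{1, x, y, xy, y²}` (parametrised by
its coefficients) to `ℝ⁵` given by the four edge integrals and the weighted volume
moment `θ̄₅` is a linear isomorphism; equivalently, the triplet
`(K̄, Q̄^{1+}, {θ̄ᵢ}ᵢ₌₁⁵)` is a finite element. -/
theorem q1plus_unisolvent : Function.Bijective q1plusDof := by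
  refine Function.bijective_iff_has_inverse.2 ⟨q1plusInterp, fun a => ?_, fun t => ?_⟩
  all_goals
    rw [q1plusDof_eq]
    ext i
    fin_cases i <;> simp [q1plusInterp] <;> ring

end
end
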